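/- Assume (H3) and ∫₀¹ f(t) dt ≥ 0. Suppose that liminf_{t → s_*⁻} (s_* − t)^{p'−1}(h(s_*) − h(t))/(−f(t)) > −∞ or limsup_{t → s_*⁺} (t − s_*)^{p'−1}(h(s_*) − h(t))/f(t) < +∞. Then there exists c* ∈ ℝ such that, for every c ∈ ℝ, the boundary value problem on [0, 1] admits a positive solution if and only if c = c*; the positive solution at c = c* is unique, and c* satisfies h_m − (p')^{1/p'} p^{1/p} μ̃^{1/p'} < c* < h_M + (p')^{1/p'} p^{1/p} μ̂^{1/p'}, both inequalities understood in the extended reals (being vacuous when μ̃ = ∞, respectively μ̂ = ∞). -/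

import Mathlib

open MeasureTheory Set Filter Topology intervalIntegral

noncomputable section

/-- A Carathéodory solution on `[a,b]` of the ODE
`y'(t) = p' * ((c - h t) * (y⁺ t)^(1/p) - f t)`, in integral form. -/
def IsCaraSol (p p' : ℝ) (h f : ℝ → ℝ) (c a b : ℝ) (y : ℝ → ℝ) : Prop :=
  ContinuousOn y (Set.Icc a b) ∧
  ∀ t ∈ Set.Icc a b,
    y t = y a + ∫ u in a..t, p' * ((c - h u) * (max (y u) 0) ^ (1 / p) - f u)

/-- A positive solution of the boundary value problem on `[a,b]`. -/
def IsPosBVPSol (p p' : ℝ) (h f : ℝ → ℝ) (c a b : ℝ) (y : ℝ → ℝ) : Prop :=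
  IsCaraSol p p' h f c a b y ∧ y a = 0 ∧ y b = 0 ∧ ∀ t ∈ Set.Ioo a b, 0 < y t

theorem AbsolutelyContinuousOnInterval.lipschitzOnWith_comp {φ y : ℝ → ℝ} {a b : ℝ} {K : NNReal}
    {S : Set ℝ} (hφ : LipschitzOnWith K φ S) (hy : AbsolutelyContinuousOnInterval y a b)
    (hm : MapsTo y (uIcc a b) S) : AbsolutelyContinuousOnInterval (fun t => φ (y t)) a b := by
  rw [absolutelyContinuousOnInterval_iff] at hy ⊢
  intro ε hε
  obtain ⟨δ, hδ, H⟩ := hy (ε / (K + 1)) (by positivity)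
  refine ⟨δ, hδ, fun E hE hEδ => ?_⟩
  have h1 := H E hE hEδ
  calc ∑ i ∈ Finset.range E.1, dist (φ (y (E.2 i).1)) (φ (y (E.2 i).2))
      ≤ ∑ i ∈ Finset.range E.1, (K : ℝ) * dist (y (E.2 i).1) (y (E.2 i).2) := by
        refine Finset.sum_le_sum fun i hi => ?_
        have := hE.1 i hi
        exact hφ.dist_le_mul _ (hm this.1) _ (hm this.2)
    _ = K * ∑ i ∈ Finset.range E.1, dist (y (E.2 i).1) (y (E.2 i).2) := by
        rw [Finset.mul_sum]
    _ ≤ K * (ε / (K + 1)) := by gcongr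
    _ < ε := by
        have hK : (0 : ℝ) ≤ K := K.2
        rw [mul_div_assoc', div_lt_iff₀ (by positivity)]
        nlinarith

theorem rpow_sub_rpow_eq_integral {y g : ℝ → ℝ} {a b : ℝ} (hab : a ≤ b) (r : ℝ)
    (hg : IntervalIntegrable g volume a b)
    (hy : ∀ t ∈ Icc a b, y t = y a + ∫ u in a..t, g u) (hpos : ∀ t ∈ Icc a b, 0 < y t) :
    y b ^ r - y a ^ r = ∫ u in a..b, r * y u ^ (r - 1) * g u := by
  set Y : ℝ → ℝ := fun t => y a + ∫ u in a..t, g u with hY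
  have hYac : AbsolutelyContinuousOnInterval Y a b := by
    have h1 := hg.absolutelyContinuousOnInterval_intervalIntegral (c := a) (by simp)
    have h2 : AbsolutelyContinuousOnInterval (fun _ : ℝ => y a) a b :=
      (LipschitzWith.const (y a)).lipschitzOnWith.absolutelyContinuousOnInterval
    exact h2.add h1
  have hYy : ∀ t ∈ Icc a b, Y t = y t := fun t ht => (hy t ht).symm
  have hYc : ContinuousOn Y (Icc a b) := by simpa [uIcc_of_le hab] using hYac.continuousOn
  obtain ⟨m, hm, hmin⟩ := isCompact_Icc.exists_isMinOn (nonempty_Icc.2 hab) hYc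
  obtain ⟨M, hM, hmax⟩ := isCompact_Icc.exists_isMaxOn (nonempty_Icc.2 hab) hYc
  have hm0 : 0 < Y m := by rw [hYy m hm]; exact hpos m hm
  have hlip : ∃ K, LipschitzOnWith K (fun x : ℝ => x ^ r) (Icc (Y m) (Y M)) := by
    refine ContDiffOn.exists_lipschitzOnWith (n := 1) (fun x hx => ?_) one_ne_zero (convex_Icc _ _)
      isCompact_Icc
    exact (Real.contDiffAt_rpow_const_of_ne (hm0.trans_le hx.1).ne').contDiffWithinAt
  obtain ⟨K, hK⟩ := hlip
  have hac := AbsolutelyContinuousOnInterval.lipschitzOnWith_comp hK hYac (fun t ht => by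
    rw [uIcc_of_le hab] at ht
    exact ⟨hmin ht, hmax ht⟩)
  have hint := hac.integral_deriv_eq_sub
  have ha : a ∈ Icc a b := left_mem_Icc.2 hab
  have hb : b ∈ Icc a b := right_mem_Icc.2 hab
  simp only [hYy a ha, hYy b hb] at hint
  rw [← hint]
  refine integral_congr_ae ?_
  filter_upwards [hg.ae_hasDerivAt_integral] with t ht htm
  have htI : t ∈ Icc a b := by
    rw [uIoc_of_le hab] at htm
    exact ⟨htm.1.le, htm.2⟩
  have hd := (ht (by rwa [uIcc_of_le hab]) a (by simp)).const_add (y a)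
  have hd2 : HasDerivAt (fun t => Y t ^ r) (g t * r * Y t ^ (r - 1)) t :=
    HasDerivAt.rpow_const (f := Y) hd (Or.inl (by rw [hYy t htI]; exact (hpos t htI).ne'))
  rw [hd2.deriv, hYy t htI]
  ring

theorem nonpos_of_antitone_where_pos {d : ℝ → ℝ} {a b : ℝ} (hd : ContinuousOn d (Icc a b))
    (h0 : d a ≤ 0)
    (hdec : ∀ τ t, a < τ → τ ≤ t → t < b → (∀ u ∈ Icc τ t, 0 < d u) → d t ≤ d τ) :
    ∀ t ∈ Icc a b, d t ≤ 0 := by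
  have key : ∀ t ∈ Ico a b, d t ≤ 0 := by
    intro t₁ ht₁
    by_contra! hpos
    have hsub : Icc a t₁ ⊆ Icc a b := Icc_subset_Icc_right ht₁.2.le
    have hcpt : IsCompact (Icc a t₁ ∩ d ⁻¹' Iic 0) :=
      isCompact_Icc.of_isClosed_subset
        ((hd.mono hsub).preimage_isClosed_of_isClosed isClosed_Icc isClosed_Iic)
        inter_subset_left
    obtain ⟨t₀, ⟨ht₀, hdt₀⟩, hgr⟩ := hcpt.exists_isGreatest ⟨a, ⟨le_rfl, ht₁.1⟩, h0⟩
    have hdt₀' : d t₀ ≤ 0 := hdt₀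
    have hlt : t₀ < t₁ := lt_of_le_of_ne ht₀.2 (by rintro rfl; linarith)
    have hp : ∀ u, t₀ < u → u ≤ t₁ → 0 < d u := by
      intro u hu hu1
      by_contra! hcon
      exact absurd (hgr ⟨⟨ht₀.1.trans hu.le, hu1⟩, hcon⟩) (not_le.2 hu)
    have htend : Tendsto d (𝓝[Ioo t₀ t₁] t₀) (𝓝 (d t₀)) :=
      ((hd t₀ (hsub ht₀)).mono (fun u hu => hsub ⟨ht₀.1.trans hu.1.le, hu.2.le⟩))
    have : NeBot (𝓝[Ioo t₀ t₁] t₀) := left_nhdsWithin_Ioo_neBot hlt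
    have hle : d t₁ ≤ d t₀ := by
      refine ge_of_tendsto htend ?_
      filter_upwards [self_mem_nhdsWithin] with τ hτ
      exact hdec τ t₁ (ht₀.1.trans_lt hτ.1) hτ.2.le ht₁.2
        (fun u hu => hp u (hτ.1.trans_le hu.1) hu.2)
    linarith
  intro t ht
  rcases ht.2.lt_or_eq with h | rfl
  · exact key t ⟨ht.1, h⟩
  · rcases ht.1.lt_or_eq with h | rfl
    · have : NeBot (𝓝[Ioo a t] t) := right_nhdsWithin_Ioo_neBot h
      refine le_of_tendsto ((hd t ht).mono Ioo_subset_Icc_self : Tendsto d (𝓝[Ioo a t] t) _) ?_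
      filter_upwards [self_mem_nhdsWithin] with τ hτ using key τ ⟨hτ.1.le, hτ.2⟩
    · exact h0

theorem intervalIntegrable_mul_of_bounded {k g : ℝ → ℝ} {K C : ℝ} (hk : Measurable k)
    (hkb : ∀ t, |k t| ≤ K) (hg : Continuous g) (hgb : ∀ t, |g t| ≤ C) (a b : ℝ) :
    IntervalIntegrable (fun u => k u * g u) volume a b := by
  refine (intervalIntegrable_const (c := K * C)).mono_fun
    (hk.mul hg.measurable).aestronglyMeasurable (ae_of_all _ fun t => ?_)
  change |k t * g t| ≤ |K * C|
  rw [abs_mul]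
  refine le_trans ?_ (le_abs_self _)
  exact mul_le_mul (hkb t) (hgb t) (abs_nonneg _) ((abs_nonneg _).trans (hkb t))

theorem exists_integral_eq_of_lipschitz {T K L C : ℝ} (hT : 0 ≤ T) {k F G : ℝ → ℝ}
    (hk : Measurable k) (hkb : ∀ t, |k t| ≤ K) (hF : Continuous F) (hL : 0 ≤ L)
    (hG : ∀ x y, |G x - G y| ≤ L * |x - y|) (hGb : ∀ x, |G x| ≤ C) :
    ∃ y : ℝ → ℝ, Continuous y ∧
      ∀ t ∈ Icc 0 T, y t = F t + ∫ u in (0 : ℝ)..t, k u * G (y u) := by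
  have hK : 0 ≤ K := (abs_nonneg _).trans (hkb 0)
  have hGc : Continuous G := by
    refine (LipschitzWith.of_dist_le_mul (K := ⟨L, hL⟩) fun x y => ?_).continuous
    rw [Real.dist_eq, Real.dist_eq]
    exact hG x y
  set l : ℝ := 2 * (K * L) + 1 with hl
  have hl0 : 0 < l := by positivity
  let ext : BoundedContinuousFunction (Icc (0 : ℝ) T) ℝ → ℝ → ℝ := fun v u =>
    Real.exp (l * u) * v (projIcc 0 T hT u)
  have hext : ∀ v, Continuous (ext v) := fun v => by
    have : Continuous fun u => v (projIcc 0 T hT u) := v.continuous.comp continuous_projIcc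
    fun_prop
  have hii : ∀ v a b, IntervalIntegrable (fun u => k u * G (ext v u)) volume a b := fun v a b =>
    intervalIntegrable_mul_of_bounded hk hkb (hGc.comp (hext v)) (fun t => hGb _) a b
  have hPc : ∀ v, Continuous fun t : Icc (0 : ℝ) T =>
      Real.exp (-l * t) * (F t + ∫ u in (0 : ℝ)..t, k u * G (ext v u)) := fun v => by
    have h1 : Continuous fun t : ℝ => ∫ u in (0 : ℝ)..t, k u * G (ext v u) :=
      continuous_primitive (hii v) 0
    have h2 : Continuous fun t : ℝ =>
      Real.exp (-l * t) * (F t + ∫ u in (0 : ℝ)..t, k u * G (ext v u)) := by fun_prop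
    exact h2.comp continuous_subtype_val
  let P : BoundedContinuousFunction (Icc (0 : ℝ) T) ℝ →
      BoundedContinuousFunction (Icc (0 : ℝ) T) ℝ :=
    fun v => BoundedContinuousFunction.mkOfCompact ⟨_, hPc v⟩
  have hP : ContractingWith (1 / 2) P := by
    refine ⟨by rw [div_lt_one] <;> norm_num, LipschitzWith.of_dist_le_mul fun v w => ?_⟩
    rw [BoundedContinuousFunction.dist_le (by positivity)]
    intro t
    have ht0 : (0 : ℝ) ≤ t := t.2.1
    have hdiff : P v t - P w t =
        Real.exp (-l * t) * ∫ u in (0 : ℝ)..t, k u * (G (ext v u) - G (ext w u)) := by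
      have : ∫ u in (0 : ℝ)..t, k u * (G (ext v u) - G (ext w u)) =
          (∫ u in (0 : ℝ)..t, k u * G (ext v u)) - ∫ u in (0 : ℝ)..t, k u * G (ext w u) := by
        rw [← integral_sub (hii v 0 t) (hii w 0 t)]
        simp only [mul_sub]
      rw [this]
      change Real.exp (-l * t) * (F t + ∫ u in (0 : ℝ)..t, k u * G (ext v u)) -
        Real.exp (-l * t) * (F t + ∫ u in (0 : ℝ)..t, k u * G (ext w u)) = _
      ring
    have hbound : |∫ u in (0 : ℝ)..t, k u * (G (ext v u) - G (ext w u))| ≤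
        ∫ u in (0 : ℝ)..t, K * L * dist v w * Real.exp (l * u) := by
      rw [← Real.norm_eq_abs]
      refine norm_integral_le_of_norm_le ht0 (ae_of_all _ fun u _ => ?_)
        (Continuous.intervalIntegrable (by fun_prop) _ _)
      rw [Real.norm_eq_abs, abs_mul]
      have h1 := hG (ext v u) (ext w u)
      have h2 : |ext v u - ext w u| ≤ Real.exp (l * u) * dist v w := by
        have : ext v u - ext w u =
          Real.exp (l * u) * (v (projIcc 0 T hT u) - w (projIcc 0 T hT u)) := by
          simp only [ext]; ring
        rw [this, abs_mul, abs_of_pos (Real.exp_pos _)]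
        gcongr
        rw [← Real.dist_eq]
        exact BoundedContinuousFunction.dist_coe_le_dist _
      calc |k u| * |G (ext v u) - G (ext w u)|
          ≤ K * (L * (Real.exp (l * u) * dist v w)) := by
            refine mul_le_mul (hkb u) (h1.trans (by gcongr)) (abs_nonneg _) hK
        _ = _ := by ring
    have hexp : ∫ u in (0 : ℝ)..t, Real.exp (l * u) = (Real.exp (l * t) - 1) / l := by
      rw [intervalIntegral.integral_comp_mul_left (fun x => Real.exp x) hl0.ne', integral_exp]
      simp [div_eq_inv_mul]
    rw [intervalIntegral.integral_const_mul, hexp] at hbound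
    rw [Real.dist_eq, hdiff, abs_mul, abs_of_pos (Real.exp_pos _)]
    calc Real.exp (-l * t) * |∫ u in (0 : ℝ)..t, k u * (G (ext v u) - G (ext w u))|
        ≤ Real.exp (-l * t) * (K * L * dist v w * ((Real.exp (l * t) - 1) / l)) := by gcongr
      _ = K * L * dist v w / l * (Real.exp (-l * t) * Real.exp (l * t) - Real.exp (-l * t)) := by
          ring
      _ = K * L * dist v w / l * (1 - Real.exp (-l * t)) := by
          rw [← Real.exp_add]; simp
      _ ≤ K * L * dist v w / l * 1 := by
          gcongr
          linarith [Real.exp_pos (-l * t)]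
      _ ≤ (1 / 2 : NNReal) * dist v w := by
          have : K * L / l ≤ 1 / 2 := by rw [div_le_iff₀ hl0]; linarith
          have h3 := mul_le_mul_of_nonneg_right this (dist_nonneg (x := v) (y := w))
          push_cast
          calc _ = K * L / l * dist v w := by ring
            _ ≤ _ := h3
  set v := ContractingWith.fixedPoint P hP with hv
  have hfix : P v = v := hP.fixedPoint_isFixedPt
  refine ⟨ext v, hext v, fun t ht => ?_⟩
  have h1 : P v ⟨t, ht⟩ = v ⟨t, ht⟩ := by rw [hfix]
  have h2 : P v ⟨t, ht⟩ =
    Real.exp (-l * t) * (F t + ∫ u in (0 : ℝ)..t, k u * G (ext v u)) := rfl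
  have h3 : ext v t = Real.exp (l * t) * v ⟨t, ht⟩ := by
    simp only [ext, projIcc_of_mem hT ht]
  rw [h3, ← h1, h2, ← mul_assoc, ← Real.exp_add]
  simp

theorem abs_rpow_sub_rpow_le {α ε a b : ℝ} (hα0 : 0 ≤ α) (hα : α ≤ 1) (hε : 0 < ε) (ha : ε ≤ a)
    (hb : ε ≤ b) : |a ^ α - b ^ α| ≤ ε ^ (α - 1) * |a - b| := by
  wlog hab : b ≤ a generalizing a b
  · rw [abs_sub_comm, abs_sub_comm a]
    exact this hb ha (le_of_not_ge hab)
  have hb0 : 0 < b := hε.trans_le hb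
  have ha0 : 0 < a := hε.trans_le ha
  rw [abs_of_nonneg (sub_nonneg.2 (Real.rpow_le_rpow hb0.le hab hα0)),
    abs_of_nonneg (sub_nonneg.2 hab)]
  have h1 : (a / b) ^ α ≤ a / b := by
    calc (a / b) ^ α ≤ (a / b) ^ (1 : ℝ) :=
          Real.rpow_le_rpow_of_exponent_le ((one_le_div hb0).2 hab) hα
      _ = a / b := Real.rpow_one _
  have h2 : a ^ α = b ^ α * (a / b) ^ α := by
    rw [← Real.mul_rpow hb0.le (by positivity)]
    congr 1
    field_simp
  calc a ^ α - b ^ α ≤ b ^ α * (a / b) - b ^ α := by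
        rw [h2]
        have := Real.rpow_pos_of_pos hb0 α
        nlinarith
    _ = b ^ (α - 1) * (a - b) := by
        rw [Real.rpow_sub_one hb0.ne']
        field_simp
    _ ≤ ε ^ (α - 1) * (a - b) := by
        refine mul_le_mul_of_nonneg_right ?_ (sub_nonneg.2 hab)
        exact Real.rpow_le_rpow_of_nonpos hε hb (by linarith)

theorem exists_add_mul_rpow_le {α : ℝ} (hα : α < 1) (A B : ℝ) :
    ∃ R : ℝ, 1 ≤ R ∧ A + B * R ^ α ≤ R := by
  have h1 : Tendsto (fun R : ℝ => R ^ (α - 1)) atTop (𝓝 0) := by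
    have := tendsto_rpow_neg_atTop (y := 1 - α) (by linarith)
    simpa using this
  have h2 : Tendsto (fun R : ℝ => A * R⁻¹ + B * R ^ (α - 1)) atTop (𝓝 (A * 0 + B * 0)) :=
    (tendsto_inv_atTop_zero.const_mul A).add (h1.const_mul B)
  rw [mul_zero, mul_zero, add_zero] at h2
  obtain ⟨R, hR, hR1⟩ := ((h2.eventually_le_const one_pos).and (eventually_ge_atTop 1)).exists
  refine ⟨R, hR1, ?_⟩
  have hR0 : 0 < R := by linarith
  rw [Real.rpow_sub_one hR0.ne'] at hR
  have := mul_le_mul_of_nonneg_right hR hR0.le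
  field_simp at this
  linarith

theorem exists_integral_eq_rpow {T K α : ℝ} (hT : 0 ≤ T) (hα0 : 0 < α) (hα : α < 1)
    {k F : ℝ → ℝ} (hk : Measurable k) (hkb : ∀ t, |k t| ≤ K) (hF : Continuous F) :
    ∃ y : ℝ → ℝ, Continuous y ∧
      ∀ t ∈ Icc 0 T, y t = F t + ∫ u in (0 : ℝ)..t, k u * (max (y u) 0) ^ α := by
  have hK : 0 ≤ K := (abs_nonneg _).trans (hkb 0)
  obtain ⟨A, hA⟩ := isCompact_Icc.exists_bound_of_continuousOn (hF.continuousOn (s := Icc 0 T))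
  obtain ⟨R, hR1, hR⟩ := exists_add_mul_rpow_le hα A (K * T)
  have hR0 : 0 < R := by linarith
  let ε : ℕ → ℝ := fun n => 1 / ((n : ℝ) + 1)
  have hε : ∀ n, 0 < ε n := fun n => by positivity
  have hε1 : ∀ n, ε n ≤ R := fun n => by
    refine le_trans ?_ hR1
    rw [div_le_one (by positivity)]
    linarith [Nat.cast_nonneg (α := ℝ) n]
  let G : ℕ → ℝ → ℝ := fun n x => (min (max x (ε n)) R) ^ α
  have hcl : ∀ n x, ε n ≤ min (max x (ε n)) R := fun n x => le_min (le_max_right _ _) (hε1 n)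
  have hGb : ∀ n x, |G n x| ≤ R ^ α := fun n x => by
    have h0 : 0 ≤ min (max x (ε n)) R := (hε n).le.trans (hcl n x)
    rw [abs_of_nonneg (Real.rpow_nonneg h0 _)]
    exact Real.rpow_le_rpow h0 (min_le_right _ _) hα0.le
  have hGl : ∀ n x y, |G n x - G n y| ≤ (ε n) ^ (α - 1) * |x - y| := fun n x y => by
    refine (abs_rpow_sub_rpow_le hα0.le hα.le (hε n) (hcl n x) (hcl n y)).trans ?_
    refine mul_le_mul_of_nonneg_left ?_ (Real.rpow_nonneg (hε n).le _)
    exact (abs_min_sub_min_le_max _ _ _ _).trans (by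
      simpa using abs_max_sub_max_le_max x (ε n) y (ε n))
  choose y hyc hy using fun n => exists_integral_eq_of_lipschitz hT hk hkb hF
    (Real.rpow_nonneg (hε n).le (α - 1)) (hGl n) (hGb n)
  have hGc : ∀ n, Continuous (G n) := fun n =>
    ((continuous_id.max continuous_const).min continuous_const).rpow_const fun _ => Or.inr hα0.le
  have hii : ∀ n a b, IntervalIntegrable (fun u => k u * G n (y n u)) volume a b := fun n a b =>
    intervalIntegrable_mul_of_bounded hk hkb ((hGc n).comp (hyc n)) (fun t => hGb _ _) a b
  have hkG : ∀ n u, ‖k u * G n (y n u)‖ ≤ K * R ^ α := fun n u => by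
    rw [Real.norm_eq_abs, abs_mul]
    exact mul_le_mul (hkb u) (hGb _ _) (abs_nonneg _) hK
  have hIb : ∀ n a b, |∫ u in a..b, k u * G n (y n u)| ≤ K * R ^ α * |b - a| := fun n a b => by
    rw [← Real.norm_eq_abs]
    exact intervalIntegral.norm_integral_le_of_norm_le_const fun u _ => hkG n u
  have hyR : ∀ n, ∀ t ∈ Icc 0 T, y n t ≤ R := fun n t ht => by
    rw [hy n t ht]
    have h1 := hA t ht
    have h2 := hIb n 0 t
    rw [Real.norm_eq_abs] at h1
    have h3 : K * R ^ α * |t - 0| ≤ K * R ^ α * T := by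
      rw [sub_zero, abs_of_nonneg ht.1]
      have := ht.2
      gcongr
    calc F t + ∫ u in (0 : ℝ)..t, k u * G n (y n u) ≤ A + K * R ^ α * T :=
          add_le_add ((le_abs_self _).trans h1) ((le_abs_self _).trans (h2.trans h3))
      _ = A + K * T * R ^ α := by ring
      _ ≤ R := hR
  have hwc : ∀ n, Continuous fun t : Icc (0 : ℝ) T =>
      ∫ u in (0 : ℝ)..t, k u * G n (y n u) := fun n =>
    (continuous_primitive (hii n) 0).comp continuous_subtype_val
  let w : ℕ → BoundedContinuousFunction (Icc (0 : ℝ) T) ℝ := fun n =>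
    BoundedContinuousFunction.mkOfCompact ⟨_, hwc n⟩
  have hwl : ∀ n (a b : Icc (0 : ℝ) T), dist (w n a) (w n b) ≤ K * R ^ α * dist a b := by
    intro n a b
    have h1 : w n a - w n b = ∫ u in (b : ℝ)..a, k u * G n (y n u) :=
      integral_interval_sub_left (hii n 0 a) (hii n 0 b)
    rw [Real.dist_eq, h1]
    exact hIb n b a
  have hcpt : IsCompact (closure (range w)) := by
    refine BoundedContinuousFunction.arzela_ascoli (Icc (-(K * R ^ α * T)) (K * R ^ α * T))
      isCompact_Icc _ ?_ ?_
    · rintro _ t ⟨n, rfl⟩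
      refine abs_le.1 ?_
      refine (hIb n 0 t).trans ?_
      rw [sub_zero, abs_of_nonneg t.2.1]
      have := t.2.2
      gcongr
    · refine LipschitzWith.uniformEquicontinuous _ ⟨K * R ^ α, by positivity⟩ ?_ |>.equicontinuous
      rintro ⟨_, n, rfl⟩
      exact LipschitzWith.of_dist_le_mul (hwl n)
  obtain ⟨w', -, φ, hφ, hlim⟩ := hcpt.tendsto_subseq (fun n => subset_closure (mem_range_self n))
  let Y : ℝ → ℝ := fun t => F t + w' (projIcc 0 T hT t)
  have hYc : Continuous Y := by
    have : Continuous fun t => w' (projIcc 0 T hT t) := w'.continuous.comp continuous_projIcc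
    fun_prop
  have hwt : ∀ t, Tendsto (fun n => w (φ n) t) atTop (𝓝 (w' t)) := fun t => by
    have := (BoundedContinuousFunction.tendsto_iff_tendstoUniformly.1 hlim)
    exact this.tendsto_at t
  have hyt : ∀ t ∈ Icc 0 T, Tendsto (fun n => y (φ n) t) atTop (𝓝 (Y t)) := by
    intro t ht
    have h1 := (hwt ⟨t, ht⟩).const_add (F t)
    have h2 : Y t = F t + w' ⟨t, ht⟩ := by simp only [Y, projIcc_of_mem hT ht]
    rw [h2]
    refine h1.congr fun n => ?_
    rw [hy (φ n) t ht]
    rfl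
  have hε0 : Tendsto (fun n => ε (φ n)) atTop (𝓝 0) :=
    tendsto_one_div_add_atTop_nhds_zero_nat.comp hφ.tendsto_atTop
  refine ⟨Y, hYc, fun t ht => ?_⟩
  refine tendsto_nhds_unique (hyt t ht) ?_
  have hdom : Tendsto (fun n => ∫ u in (0 : ℝ)..t, k u * G (φ n) (y (φ n) u)) atTop
      (𝓝 (∫ u in (0 : ℝ)..t, k u * (max (Y u) 0) ^ α)) := by
    refine intervalIntegral.tendsto_integral_filter_of_dominated_convergence
      (fun _ => K * R ^ α) (Eventually.of_forall fun n => ?_)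
      (Eventually.of_forall fun n => ae_of_all _ fun u _ => hkG _ u) intervalIntegrable_const
      (ae_of_all _ fun u hu => ?_)
    · exact (hk.mul ((hGc (φ n)).comp (hyc (φ n))).measurable).aestronglyMeasurable
    · rw [uIoc_of_le ht.1] at hu
      have huI : u ∈ Icc 0 T := ⟨hu.1.le, hu.2.trans ht.2⟩
      refine Tendsto.const_mul _ ?_
      have h1 : Tendsto (fun n => (max (y (φ n) u) (ε (φ n))) ^ α) atTop
          (𝓝 ((max (Y u) 0) ^ α)) :=
        ((hyt u huI).max hε0).rpow_const (Or.inr hα0.le)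
      refine h1.congr fun n => ?_
      simp only [G]
      rw [min_eq_left (max_le (hyR _ u huI) (hε1 _))]
  refine (hdom.const_add (F t)).congr fun n => ?_
  rw [hy (φ n) t ht]

theorem intervalIntegrable_rhs {p p' c a b M : ℝ} {h f y : ℝ → ℝ} (hp : 0 < p) (hab : a ≤ b)
    (hmeas : Measurable h) (hbd : ∀ t ∈ Icc a b, |h t| ≤ M) (hf : IntegrableOn f (Ioo a b))
    (hy : ContinuousOn y (Icc a b)) :
    IntervalIntegrable (fun u => p' * ((c - h u) * (max (y u) 0) ^ (1 / p) - f u)) volume a b := by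
  have hfi : IntervalIntegrable f volume a b := by
    rwa [intervalIntegrable_iff_integrableOn_Ioo_of_le hab]
  have hhi : IntervalIntegrable h volume a b := by
    rw [intervalIntegrable_iff_integrableOn_Icc_of_le hab]
    refine Measure.integrableOn_of_bounded (M := M) (by simp) hmeas.aestronglyMeasurable ?_
    filter_upwards [ae_restrict_mem measurableSet_Icc] with t ht using hbd t ht
  have hyc : ContinuousOn (fun u => (max (y u) 0) ^ (1 / p)) (uIcc a b) := by
    rw [uIcc_of_le hab]
    exact (hy.sup continuousOn_const).rpow_const fun _ _ => Or.inr (by positivity)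
  exact ((((intervalIntegrable_const (c := c)).sub hhi).mul_continuousOn hyc).sub hfi).const_mul p'

namespace IsCaraSol

variable {p p' c a b M : ℝ} {h f y : ℝ → ℝ}

theorem sub_eq_integral (hy : IsCaraSol p p' h f c a b y)
    (hi : IntervalIntegrable (fun u => p' * ((c - h u) * (max (y u) 0) ^ (1 / p) - f u))
      volume a b) {τ t : ℝ} (hτ : τ ∈ Icc a b) (ht : t ∈ Icc a b) :
    y t - y τ = ∫ u in τ..t, p' * ((c - h u) * (max (y u) 0) ^ (1 / p) - f u) := by
  have hab : a ≤ b := hτ.1.trans hτ.2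
  have hsub : ∀ r ∈ Icc a b, IntervalIntegrable
      (fun u => p' * ((c - h u) * (max (y u) 0) ^ (1 / p) - f u)) volume a r := fun r hr =>
    hi.mono_set (by rw [uIcc_of_le hr.1, uIcc_of_le hab]; exact Icc_subset_Icc_right hr.2)
  rw [hy.2 t ht, hy.2 τ hτ, ← integral_interval_sub_left (hsub t ht) (hsub τ hτ)]
  ring

theorem restrict (hy : IsCaraSol p p' h f c a b y)
    (hi : IntervalIntegrable (fun u => p' * ((c - h u) * (max (y u) 0) ^ (1 / p) - f u))
      volume a b) {a' b' : ℝ} (ha : a ≤ a') (hb : b' ≤ b) : IsCaraSol p p' h f c a' b' y := by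
  refine ⟨hy.1.mono (Icc_subset_Icc ha hb), fun t ht => ?_⟩
  rw [← hy.sub_eq_integral hi ⟨ha, (ht.1.trans ht.2).trans hb⟩ ⟨ha.trans ht.1, ht.2.trans hb⟩]
  ring

theorem glue {m : ℝ} {y₁ y₂ : ℝ → ℝ} (h₁ : IsCaraSol p p' h f c a m y₁)
    (h₂ : IsCaraSol p p' h f c m b y₂) (ham : a ≤ m) (hmb : m ≤ b) (hm : y₁ m = y₂ m)
    (hi₁ : IntervalIntegrable (fun u => p' * ((c - h u) * (max (y₁ u) 0) ^ (1 / p) - f u))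
      volume a m)
    (hi₂ : IntervalIntegrable (fun u => p' * ((c - h u) * (max (y₂ u) 0) ^ (1 / p) - f u))
      volume m b) :
    IsCaraSol p p' h f c a b (fun t => if t ≤ m then y₁ t else y₂ t) := by
  have he₁ : ∀ t ≤ m, (if t ≤ m then y₁ t else y₂ t) = y₁ t := fun t ht => if_pos ht
  have he₂ : ∀ t, m ≤ t → (if t ≤ m then y₁ t else y₂ t) = y₂ t := fun t ht => by
    rcases ht.lt_or_eq with h | rfl
    · exact if_neg (not_le.2 h)
    · rw [if_pos le_rfl, hm]
  have hI₁ : ∀ t ∈ Icc a m, ∫ u in a..t, p' * ((c - h u) *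
      (max (if u ≤ m then y₁ u else y₂ u) 0) ^ (1 / p) - f u) = y₁ t - y₁ a := fun t ht => by
    rw [h₁.2 t ht, add_sub_cancel_left]
    refine integral_congr fun u hu => ?_
    rw [uIcc_of_le ht.1] at hu
    simp only [he₁ u (hu.2.trans ht.2)]
  refine ⟨?_, fun t ht => ?_⟩
  · rw [← Icc_union_Icc_eq_Icc ham hmb]
    refine ContinuousOn.union_of_isClosed ?_ ?_ isClosed_Icc isClosed_Icc
    · exact h₁.1.congr fun t ht => he₁ t ht.2
    · exact h₂.1.congr fun t ht => he₂ t ht.1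
  · dsimp only
    rw [he₁ a ham]
    rcases le_total t m with htm | htm
    · rw [he₁ t htm, hI₁ t ⟨ht.1, htm⟩]
      ring
    · have hI₂ : ∫ u in m..t, p' * ((c - h u) *
          (max (if u ≤ m then y₁ u else y₂ u) 0) ^ (1 / p) - f u) = y₂ t - y₂ m := by
        rw [h₂.2 t ⟨htm, ht.2⟩, add_sub_cancel_left]
        refine integral_congr fun u hu => ?_
        rw [uIcc_of_le htm] at hu
        simp only [he₂ u hu.1]
      rw [he₂ t htm, ← integral_add_adjacent_intervals (b := m), hI₁ m ⟨ham, le_rfl⟩, hI₂, hm]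
      · ring
      · refine hi₁.congr fun u hu => ?_
        rw [uIoc_of_le ham] at hu
        simp only [he₁ u hu.2]
      · refine (hi₂.mono_set (by
          rw [uIcc_of_le htm, uIcc_of_le hmb]; exact Icc_subset_Icc_right ht.2)).congr fun u hu => ?_
        rw [uIoc_of_le htm] at hu
        simp only [he₂ u hu.1.le]

theorem reflect (hy : IsCaraSol p p' h f c a b y)
    (hi : IntervalIntegrable (fun u => p' * ((c - h u) * (max (y u) 0) ^ (1 / p) - f u))
      volume a b) :
    IsCaraSol p p' (fun t => -h (1 - t)) (fun t => -f (1 - t)) (-c) (1 - b) (1 - a)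
      (fun t => y (1 - t)) := by
  have hmaps : MapsTo (fun t : ℝ => 1 - t) (Icc (1 - b) (1 - a)) (Icc a b) := fun t ht =>
    ⟨by linarith [ht.2], by linarith [ht.1]⟩
  refine ⟨hy.1.comp (by fun_prop) hmaps, fun t ht => ?_⟩
  have hab : a ≤ b := by linarith [ht.1.trans ht.2]
  have h1 := hy.sub_eq_integral hi (right_mem_Icc.2 hab) (hmaps ht)
  have h2 : ∫ u in (1 - b)..t, p' * ((-c - -h (1 - u)) * (max (y (1 - u)) 0) ^ (1 / p) -
      -f (1 - u)) = -∫ u in (1 - b)..t,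
        (fun v => p' * ((c - h v) * (max (y v) 0) ^ (1 / p) - f v)) (1 - u) := by
    rw [← intervalIntegral.integral_neg]
    refine integral_congr fun u _ => ?_
    simp only
    ring
  rw [h2, intervalIntegral.integral_comp_sub_left
    (fun v => p' * ((c - h v) * (max (y v) 0) ^ (1 / p) - f v)), ← integral_symm, sub_sub_cancel,
    ← h1]
  simp only [sub_sub_cancel]
  ring

theorem rpow_sub_rpow (hy : IsCaraSol p p' h f c a b y) (hp : 1 < p) (hp' : p' = p / (p - 1))
    (hi : IntervalIntegrable (fun u => p' * ((c - h u) * (max (y u) 0) ^ (1 / p) - f u))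
      volume a b) {τ t : ℝ} (hτ : a ≤ τ) (hτt : τ ≤ t) (ht : t ≤ b)
    (hpos : ∀ u ∈ Icc τ t, 0 < y u) :
    IntervalIntegrable (fun u => c - h u - f u * y u ^ (-(1 / p))) volume τ t ∧
      y t ^ (1 / p') - y τ ^ (1 / p') = ∫ u in τ..t, (c - h u - f u * y u ^ (-(1 / p))) := by
  have hp1 : 0 < p - 1 := by linarith
  have hp0 : 0 < p := by linarith
  have hr : 1 / p' - 1 = -(1 / p) := by rw [hp']; field_simp; linarith
  have hrp : 1 / p' * p' = 1 := by
    have : 0 < p' := by rw [hp']; positivity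
    field_simp
  have hpt : ∀ u ∈ Icc τ t, 1 / p' * y u ^ (1 / p' - 1) *
      (p' * ((c - h u) * (max (y u) 0) ^ (1 / p) - f u)) = c - h u - f u * y u ^ (-(1 / p)) := by
    intro u hu
    have h0 := hpos u hu
    rw [hr, max_eq_left h0.le]
    have h1 : y u ^ (-(1 / p)) * y u ^ (1 / p) = 1 := by
      rw [← Real.rpow_add h0]; simp
    linear_combination (y u ^ (-(1 / p)) * ((c - h u) * (y u) ^ (1 / p) - f u)) * hrp +
      (c - h u) * h1
  have hi' : IntervalIntegrable (fun u => p' * ((c - h u) * (max (y u) 0) ^ (1 / p) - f u))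
      volume τ t := hi.mono_set (by
    rw [uIcc_of_le hτt, uIcc_of_le (hτ.trans (hτt.trans ht))]; exact Icc_subset_Icc hτ ht)
  have hyc : ContinuousOn y (Icc τ t) := hy.1.mono (Icc_subset_Icc hτ ht)
  constructor
  · have : IntervalIntegrable (fun u => 1 / p' * y u ^ (1 / p' - 1) *
      (p' * ((c - h u) * (max (y u) 0) ^ (1 / p) - f u))) volume τ t := by
      refine hi'.continuousOn_mul ?_
      rw [uIcc_of_le hτt]
      exact continuousOn_const.mul (hyc.rpow_const fun u hu => Or.inl (hpos u hu).ne')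
    refine this.congr fun u hu => ?_
    rw [uIoc_of_le hτt] at hu
    exact hpt u ⟨hu.1.le, hu.2⟩
  · rw [rpow_sub_rpow_eq_integral hτt (1 / p') hi' (hy.restrict hi hτ ht).2 hpos]
    refine integral_congr fun u hu => ?_
    rw [uIcc_of_le hτt] at hu
    exact hpt u hu

end IsCaraSol

theorem exists_forall_mem_Icc_of_eventually {a b : ℝ} {P : ℝ → Prop} (hab : a < b)
    (hP : ∀ᶠ u in 𝓝[Icc a b] b, P u) : ∃ t ∈ Ioo a b, ∀ u ∈ Icc t b, P u := by
  obtain ⟨ε, hε, hB⟩ := Metric.mem_nhdsWithin_iff.1 hP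
  obtain ⟨t, ht, htb⟩ := exists_between (max_lt hab (sub_lt_self b hε))
  rw [max_lt_iff] at ht
  refine ⟨t, ⟨ht.1, htb⟩, fun u hu => hB ⟨?_, ht.1.le.trans hu.1, hu.2⟩⟩
  rw [Metric.mem_ball, Real.dist_eq, abs_lt]
  constructor <;> linarith [hu.1, hu.2]

/-- The data of the equation on `[0, s]`, where the reaction term `f` is negative. -/
structure HalfProblem (p p' s : ℝ) (h f : ℝ → ℝ) : Prop where
  one_lt : 1 < p
  conj_eq : p' = p / (p - 1)
  pos : 0 < s
  measurable : Measurable h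
  bounded : ∃ M : ℝ, ∀ t ∈ Icc 0 s, |h t| ≤ M
  integrableOn : IntegrableOn f (Ioo 0 s)
  zero_right : f s = 0
  neg : ∀ t ∈ Ioo 0 s, f t < 0
  usc : UpperSemicontinuousOn f (Ioo 0 s)

/-- Carathéodory solutions on `[0, s]` starting from `0` that are positive on `(0, s)`. -/
structure IsHalfSol (p p' s : ℝ) (h f : ℝ → ℝ) (c : ℝ) (y : ℝ → ℝ) : Prop where
  cara : IsCaraSol p p' h f c 0 s y
  zero : y 0 = 0
  pos : ∀ t ∈ Ioo 0 s, 0 < y t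

namespace HalfProblem

variable {p p' s c c₁ c₂ : ℝ} {h f y y₁ y₂ : ℝ → ℝ}

theorem p_pos (H : HalfProblem p p' s h f) : 0 < p := by linarith [H.one_lt]

theorem conj_pos (H : HalfProblem p p' s h f) : 0 < p' := by
  rw [H.conj_eq]
  exact div_pos H.p_pos (by linarith [H.one_lt])

theorem conj_sub_one_pos (H : HalfProblem p p' s h f) : 0 < p' - 1 := by
  have := H.one_lt
  have h1 : 0 < p - 1 := by linarith
  rw [H.conj_eq, sub_pos, one_lt_div h1]
  linarith

theorem one_div_conj_mul (H : HalfProblem p p' s h f) : 1 / p' * (p' - 1) = 1 / p := by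
  have h1 : p - 1 ≠ 0 := by linarith [H.one_lt]
  have h2 := H.p_pos.ne'
  rw [H.conj_eq]
  field_simp
  ring

theorem intervalIntegrable (H : HalfProblem p p' s h f) (c : ℝ) (hy : ContinuousOn y (Icc 0 s)) :
    IntervalIntegrable (fun u => p' * ((c - h u) * (max (y u) 0) ^ (1 / p) - f u))
      volume 0 s := by
  obtain ⟨M, hM⟩ := H.bounded
  exact intervalIntegrable_rhs H.p_pos H.pos.le H.measurable hM H.integrableOn hy

theorem intervalIntegrable_sub (H : HalfProblem p p' s h f) (c : ℝ)
    (hy : ContinuousOn y (Icc 0 s)) {τ t : ℝ} (hτ : τ ∈ Icc 0 s) (ht : t ∈ Icc 0 s) :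
    IntervalIntegrable (fun u => p' * ((c - h u) * (max (y u) 0) ^ (1 / p) - f u))
      volume τ t := by
  refine (H.intervalIntegrable c hy).mono_set ?_
  rw [uIcc_of_le H.pos.le]
  exact uIcc_subset_Icc hτ ht

theorem f_nonpos (H : HalfProblem p p' s h f) {u : ℝ} (h0 : 0 < u) (hs : u ≤ s) : f u ≤ 0 := by
  rcases hs.lt_or_eq with h1 | rfl
  · exact (H.neg u ⟨h0, h1⟩).le
  · exact H.zero_right.le

theorem continuousOn_rpow (H : HalfProblem p p' s h f) (hy : IsHalfSol p p' s h f c y) :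
    ContinuousOn (fun t => y t ^ (1 / p')) (Icc 0 s) :=
  hy.cara.1.rpow_const fun _ _ => Or.inr (one_div_pos.2 H.conj_pos).le

theorem zero_rpow (H : HalfProblem p p' s h f) (hy : IsHalfSol p p' s h f c y) :
    y 0 ^ (1 / p') = 0 := by
  rw [hy.zero, Real.zero_rpow (one_div_pos.2 H.conj_pos).ne']

theorem rpow_sub_rpow (H : HalfProblem p p' s h f) (hy : IsHalfSol p p' s h f c y) {τ t : ℝ}
    (hτ : 0 < τ) (hτt : τ ≤ t) (ht : t < s) :
    IntervalIntegrable (fun u => c - h u - f u * y u ^ (-(1 / p))) volume τ t ∧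
      y t ^ (1 / p') - y τ ^ (1 / p') = ∫ u in τ..t, (c - h u - f u * y u ^ (-(1 / p))) :=
  hy.cara.rpow_sub_rpow H.one_lt H.conj_eq (H.intervalIntegrable c hy.cara.1) hτ.le hτt ht.le
    fun u hu => hy.pos u ⟨hτ.trans_le hu.1, hu.2.trans_lt ht⟩

theorem nonneg (hy : IsHalfSol p p' s h f c y) : ∀ t ∈ Icc 0 s, 0 ≤ y t := by
  intro t ht
  have := nonpos_of_antitone_where_pos (d := fun t => -y t) hy.cara.1.neg (by simp [hy.zero])
    (fun τ t h1 h2 h3 h4 => by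
      have h5 := h4 τ ⟨le_rfl, h2⟩
      have h6 := hy.pos τ ⟨h1, h2.trans_lt h3⟩
      linarith) t ht
  linarith

theorem neg_mul_rpow_le (H : HalfProblem p p' s h f) {u a b : ℝ} (hu : u ∈ Ioo 0 s) (ha : 0 < a)
    (hab : a ≤ b) : -(f u * b ^ (-(1 / p))) ≤ -(f u * a ^ (-(1 / p))) := by
  have h1 := H.neg u hu
  have h2 : b ^ (-(1 / p)) ≤ a ^ (-(1 / p)) :=
    Real.rpow_le_rpow_of_nonpos ha hab (by have := H.p_pos; simp [this.le])
  nlinarith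

theorem rpow_mono (H : HalfProblem p p' s h f) (hy₁ : IsHalfSol p p' s h f c₁ y₁)
    (hy₂ : IsHalfSol p p' s h f c₂ y₂) (hc : c₁ ≤ c₂) :
    ∀ t ∈ Icc 0 s, y₁ t ^ (1 / p') ≤ y₂ t ^ (1 / p') := by
  intro t ht
  have hq := one_div_pos.2 H.conj_pos
  have := nonpos_of_antitone_where_pos (d := fun t => y₁ t ^ (1 / p') - y₂ t ^ (1 / p'))
    ((H.continuousOn_rpow hy₁).sub (H.continuousOn_rpow hy₂))
    (by simp only [H.zero_rpow hy₁, H.zero_rpow hy₂]; simp)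
    (fun τ t h1 h2 h3 h4 => by
      obtain ⟨i1, e1⟩ := H.rpow_sub_rpow hy₁ h1 h2 h3
      obtain ⟨i2, e2⟩ := H.rpow_sub_rpow hy₂ h1 h2 h3
      have := integral_mono_on h2 i1 i2 fun u hu => by
        have huI : u ∈ Ioo 0 s := ⟨h1.trans_le hu.1, hu.2.trans_lt h3⟩
        have h5 : y₂ u < y₁ u := (Real.rpow_lt_rpow_iff (hy₂.pos u huI).le (hy₁.pos u huI).le hq).1
          (sub_pos.1 (h4 u hu))
        have := H.neg_mul_rpow_le huI (hy₂.pos u huI) h5.le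
        linarith
      linarith) t ht
  linarith

theorem mono (H : HalfProblem p p' s h f) (hy₁ : IsHalfSol p p' s h f c₁ y₁)
    (hy₂ : IsHalfSol p p' s h f c₂ y₂) (hc : c₁ ≤ c₂) : ∀ t ∈ Icc 0 s, y₁ t ≤ y₂ t :=
  fun t ht => (Real.rpow_le_rpow_iff (nonneg hy₁ t ht) (nonneg hy₂ t ht)
    (one_div_pos.2 H.conj_pos)).1 (H.rpow_mono hy₁ hy₂ hc t ht)

theorem unique (H : HalfProblem p p' s h f) (hy₁ : IsHalfSol p p' s h f c y₁)
    (hy₂ : IsHalfSol p p' s h f c y₂) : EqOn y₁ y₂ (Icc 0 s) := fun t ht =>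
  le_antisymm (H.mono hy₁ hy₂ le_rfl t ht) (H.mono hy₂ hy₁ le_rfl t ht)

theorem rpow_sub_le (H : HalfProblem p p' s h f) (hy₁ : IsHalfSol p p' s h f c₁ y₁)
    (hy₂ : IsHalfSol p p' s h f c₂ y₂) (hc : c₁ ≤ c₂) :
    ∀ t ∈ Icc 0 s, y₂ t ^ (1 / p') - y₁ t ^ (1 / p') ≤ (c₂ - c₁) * t := by
  intro t ht
  have hq := one_div_pos.2 H.conj_pos
  have := nonpos_of_antitone_where_pos
    (d := fun t => y₂ t ^ (1 / p') - y₁ t ^ (1 / p') - (c₂ - c₁) * t)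
    (((H.continuousOn_rpow hy₂).sub (H.continuousOn_rpow hy₁)).sub (by fun_prop))
    (by simp only [H.zero_rpow hy₁, H.zero_rpow hy₂]; simp)
    (fun τ t h1 h2 h3 h4 => by
      obtain ⟨i1, e1⟩ := H.rpow_sub_rpow hy₁ h1 h2 h3
      obtain ⟨i2, e2⟩ := H.rpow_sub_rpow hy₂ h1 h2 h3
      have := integral_mono_on h2 i2 (i1.add (intervalIntegrable_const (c := c₂ - c₁)))
        fun u hu => by
          have huI : u ∈ Ioo 0 s := ⟨h1.trans_le hu.1, hu.2.trans_lt h3⟩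
          have h6 : 0 ≤ (c₂ - c₁) * u := mul_nonneg (sub_nonneg.2 hc) huI.1.le
          have h5 : y₁ u < y₂ u :=
            (Real.rpow_lt_rpow_iff (hy₁.pos u huI).le (hy₂.pos u huI).le hq).1 (by
              have := h4 u hu
              linarith)
          have := H.neg_mul_rpow_le huI (hy₁.pos u huI) h5.le
          linarith
      rw [integral_add i1 intervalIntegrable_const, intervalIntegral.integral_const,
        smul_eq_mul] at this
      linarith) t ht
  linarith

theorem mul_le_rpow (H : HalfProblem p p' s h f) (hy : IsHalfSol p p' s h f c y) {M : ℝ}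
    (hM : ∀ t ∈ Icc 0 s, |h t| ≤ M) : ∀ t ∈ Icc 0 s, (c - M) * t ≤ y t ^ (1 / p') := by
  intro t ht
  have := nonpos_of_antitone_where_pos
    (d := fun t => (c - M) * t - y t ^ (1 / p'))
    (ContinuousOn.sub (by fun_prop) (H.continuousOn_rpow hy))
    (by simp only [H.zero_rpow hy]; simp)
    (fun τ t h1 h2 h3 h4 => by
      obtain ⟨i1, e1⟩ := H.rpow_sub_rpow hy h1 h2 h3
      have := integral_mono_on h2 (intervalIntegrable_const (c := c - M)) i1
        fun u hu => by
          have huI : u ∈ Ioo 0 s := ⟨h1.trans_le hu.1, hu.2.trans_lt h3⟩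
          have h5 := (abs_le.1 (hM u (Ioo_subset_Icc_self huI))).2
          have h6 := mul_nonneg (neg_nonneg.2 (H.neg u huI).le)
            (Real.rpow_nonneg (hy.pos u huI).le (-(1 / p)))
          linarith
      rw [intervalIntegral.integral_const, smul_eq_mul] at this
      linarith) t ht
  linarith

theorem right_eq_zero_of_le (H : HalfProblem p p' s h f) (hy : IsHalfSol p p' s h f c y)
    {κ μ A : ℝ} (hκ : ∀ t ∈ Ioo 0 s, c - h t ≤ -κ)
    (hμ : ∀ t ∈ Ioo 0 s, -f t ≤ μ * (s - t) ^ (p' - 1)) (hA : 0 < A)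
    (hAκ : A + μ * A ^ (-(p' - 1)) ≤ κ) : y s = 0 := by
  have hq := one_div_pos.2 H.conj_pos
  have key := nonpos_of_antitone_where_pos
    (d := fun t => y t ^ (1 / p') - A * (s - t))
    ((H.continuousOn_rpow hy).sub (by fun_prop))
    (by simp only [H.zero_rpow hy]; have := mul_pos hA H.pos; linarith)
    (fun τ t h1 h2 h3 h4 => by
      obtain ⟨i1, e1⟩ := H.rpow_sub_rpow hy h1 h2 h3
      have := integral_mono_on h2 i1 (intervalIntegrable_const (c := -A))
        fun u hu => by
          have huI : u ∈ Ioo 0 s := ⟨h1.trans_le hu.1, hu.2.trans_lt h3⟩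
          have hsu : 0 < s - u := sub_pos.2 huI.2
          have h5 : A * (s - u) ≤ y u ^ (1 / p') := by
            have := h4 u hu
            linarith
          have h6 : y u ^ (-(1 / p)) ≤ A ^ (-(p' - 1)) * (s - u) ^ (-(p' - 1)) := by
            rw [← Real.mul_rpow hA.le hsu.le, ← H.one_div_conj_mul, ← mul_neg,
              Real.rpow_mul (hy.pos u huI).le]
            exact Real.rpow_le_rpow_of_nonpos (mul_pos hA hsu) h5 (by linarith [H.conj_sub_one_pos])
          have h7 : (-f u) * y u ^ (-(1 / p)) ≤
              μ * (s - u) ^ (p' - 1) * (A ^ (-(p' - 1)) * (s - u) ^ (-(p' - 1))) :=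
            mul_le_mul (hμ u huI) h6 (Real.rpow_nonneg (hy.pos u huI).le _)
              ((neg_nonneg.2 (H.neg u huI).le).trans (hμ u huI))
          have h8 : (s - u) ^ (p' - 1) * (s - u) ^ (-(p' - 1)) = 1 := by
            rw [← Real.rpow_add hsu]; simp
          have h9 : μ * (s - u) ^ (p' - 1) * (A ^ (-(p' - 1)) * (s - u) ^ (-(p' - 1))) =
              μ * A ^ (-(p' - 1)) := by
            linear_combination (μ * A ^ (-(p' - 1))) * h8
          have := hκ u huI
          linarith
      rw [intervalIntegral.integral_const, smul_eq_mul] at this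
      linarith) s (right_mem_Icc.2 H.pos.le)
  have h0 := nonneg hy s (right_mem_Icc.2 H.pos.le)
  rcases h0.eq_or_lt with h1 | h1
  · exact h1.symm
  · have := Real.rpow_pos_of_pos h1 (1 / p')
    simp only [sub_self, mul_zero, sub_zero] at key
    linarith

theorem le_of_right_eq_zero (H : HalfProblem p p' s h f) (hy : IsHalfSol p p' s h f c y)
    (hhc : ContinuousAt h s) (hys : y s = 0) : c ≤ h s := by
  by_contra! hc
  have h1 : ∀ᶠ u in 𝓝[Icc 0 s] s, h u < c :=
    nhdsWithin_le_nhds (hhc.eventually_lt_const hc)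
  obtain ⟨t, ht, hP⟩ := exists_forall_mem_Icc_of_eventually H.pos h1
  have h2 := hy.cara.sub_eq_integral (H.intervalIntegrable c hy.cara.1)
    (Ioo_subset_Icc_self ht) (right_mem_Icc.2 H.pos.le)
  have h3 : 0 ≤ ∫ u in t..s, p' * ((c - h u) * (max (y u) 0) ^ (1 / p) - f u) := by
    refine integral_nonneg ht.2.le fun u hu => mul_nonneg H.conj_pos.le ?_
    have h4 := H.f_nonpos (ht.1.trans_le hu.1) hu.2
    have h5 := mul_nonneg (sub_nonneg.2 (hP u hu).le)
      (Real.rpow_nonneg (le_max_right (y u) 0) (1 / p))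
    linarith
  have := hy.pos t ht
  linarith

theorem right_ne_zero (H : HalfProblem p p' s h f) (hy : IsHalfSol p p' s h f (h s) y)
    (hhc : ContinuousAt h s) {k : ℝ}
    (hev : ∀ᶠ t in 𝓝[<] s, k < (s - t) ^ (p' - 1) * (h s - h t) / (-f t)) : y s ≠ 0 := by
  intro hys
  have hq := H.conj_sub_one_pos
  obtain ⟨ε, hε, hεk⟩ : ∃ ε : ℝ, 0 < ε ∧ |k| * ε ^ (p' - 1) ≤ 1 := by
    refine ⟨((|k| + 1)⁻¹) ^ (1 / (p' - 1)), by positivity, ?_⟩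
    rw [← Real.rpow_mul (by positivity), one_div_mul_cancel hq.ne', Real.rpow_one,
      ← div_eq_mul_inv, div_le_one (by positivity)]
    linarith
  have hev1 : ∀ᶠ u in 𝓝[Icc 0 s] s, h s - ε < h u ∧ h u < h s + ε :=
    nhdsWithin_le_nhds ((hhc.eventually_const_lt (by linarith)).and
      (hhc.eventually_lt_const (by linarith)))
  have hev2 : ∀ᶠ u in 𝓝[Icc 0 s] s,
      u < s → k < (s - u) ^ (p' - 1) * (h s - h u) / (-f u) :=
    nhdsWithin_le_nhds (eventually_nhdsWithin_iff.1 hev)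
  obtain ⟨t, ht, hP⟩ := exists_forall_mem_Icc_of_eventually H.pos (hev1.and hev2)
  have hz : ∀ u ∈ Ico t s, y u ^ (1 / p') ≤ ε * (s - u) := by
    intro u hu
    have hu0 : 0 < u := ht.1.trans_le hu.1
    have hle : ∀ r ∈ Ioo u s, y u ^ (1 / p') ≤ y r ^ (1 / p') + ε * (r - u) := by
      intro r hr
      obtain ⟨i1, e1⟩ := H.rpow_sub_rpow hy hu0 hr.1.le hr.2
      have := integral_mono_on hr.1.le (intervalIntegrable_const (c := -ε)) i1 fun v hv => by
        have hvI : v ∈ Ioo 0 s := ⟨hu0.trans_le hv.1, hv.2.trans_lt hr.2⟩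
        have h5 := (hP v ⟨hu.1.trans hv.1, hvI.2.le⟩).1.2
        have h6 := mul_nonneg (neg_nonneg.2 (H.neg v hvI).le)
          (Real.rpow_nonneg (hy.pos v hvI).le (-(1 / p)))
        linarith
      rw [intervalIntegral.integral_const, smul_eq_mul] at this
      linarith
    have : NeBot (𝓝[Ioo u s] s) := right_nhdsWithin_Ioo_neBot hu.2
    have hc : ContinuousOn (fun r => y r ^ (1 / p') + ε * (r - u)) (Icc 0 s) :=
      (H.continuousOn_rpow hy).add (by fun_prop)
    have hlim := (hc s (right_mem_Icc.2 H.pos.le)).mono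
      (fun r hr => ⟨hu0.le.trans hr.1.le, hr.2.le⟩ : Ioo u s ⊆ Icc 0 s)
    have := ge_of_tendsto (f := fun r => y r ^ (1 / p') + ε * (r - u)) hlim
      (by filter_upwards [self_mem_nhdsWithin] with r hr using hle r hr)
    dsimp only at this
    rwa [hys, Real.zero_rpow (one_div_pos.2 H.conj_pos).ne', zero_add] at this
  have h2 := hy.cara.sub_eq_integral (H.intervalIntegrable (h s) hy.cara.1)
    (Ioo_subset_Icc_self ht) (right_mem_Icc.2 H.pos.le)
  have h3 : 0 ≤ ∫ u in t..s, p' * ((h s - h u) * (max (y u) 0) ^ (1 / p) - f u) := by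
    refine integral_nonneg ht.2.le fun u hu => mul_nonneg H.conj_pos.le ?_
    rcases hu.2.eq_or_lt with rfl | hus
    · simp [H.zero_right]
    have huI : u ∈ Ioo 0 s := ⟨ht.1.trans_le hu.1, hus⟩
    have hsu : 0 < s - u := sub_pos.2 hus
    have hf := neg_pos.2 (H.neg u huI)
    have h4 := (hP u hu).2 hus
    rw [lt_div_iff₀ hf] at h4
    have hy0 := hy.pos u huI
    rw [max_eq_left hy0.le]
    have h5 : y u ^ (1 / p) ≤ ε ^ (p' - 1) * (s - u) ^ (p' - 1) := by
      rw [← Real.mul_rpow hε.le hsu.le, ← H.one_div_conj_mul, Real.rpow_mul hy0.le]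
      exact Real.rpow_le_rpow (Real.rpow_nonneg hy0.le _) (hz u ⟨hu.1, hus⟩) hq.le
    have hS := Real.rpow_pos_of_pos hsu (p' - 1)
    have hY := Real.rpow_pos_of_pos hy0 (1 / p)
    rcases le_total 0 (h s - h u) with h6 | h6
    · have := mul_nonneg h6 hY.le
      linarith
    · have h7 : (h s - h u) * (ε ^ (p' - 1) * (s - u) ^ (p' - 1)) ≤
          (h s - h u) * y u ^ (1 / p) := mul_le_mul_of_nonpos_left h5 h6
      have h8 : ε ^ (p' - 1) * (-|k| * -f u) ≤
          ε ^ (p' - 1) * ((s - u) ^ (p' - 1) * (h s - h u)) := by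
        refine mul_le_mul_of_nonneg_left ?_ (Real.rpow_nonneg hε.le _)
        have := mul_le_mul_of_nonneg_right (neg_abs_le k) hf.le
        linarith
      have h9 : |k| * ε ^ (p' - 1) * -f u ≤ 1 * -f u := mul_le_mul_of_nonneg_right hεk hf.le
      linarith
  have := hy.pos t ht
  linarith

theorem right_eq_zero_of_right_eq (H : HalfProblem p p' s h f)
    (hy₁ : IsHalfSol p p' s h f c₁ y₁) (hy₂ : IsHalfSol p p' s h f c₂ y₂) (hc : c₁ < c₂)
    (hys : y₁ s = y₂ s) : y₂ s = 0 := by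
  have hsI : s ∈ Icc 0 s := right_mem_Icc.2 H.pos.le
  by_contra hne
  have hpos : 0 < y₂ s := lt_of_le_of_ne (nonneg hy₂ s hsI) (Ne.symm hne)
  obtain ⟨M, hM⟩ := H.bounded
  have hα : 0 ≤ 1 / p := (one_div_pos.2 H.p_pos).le
  have hYc : ∀ {y : ℝ → ℝ}, ContinuousOn y (Icc 0 s) →
      ContinuousOn (fun u => (max (y u) 0) ^ (1 / p)) (Icc 0 s) := fun hy =>
    (hy.sup continuousOn_const).rpow_const fun _ _ => Or.inr hα
  set ψ : ℝ → ℝ := fun u => (c₂ - c₁) * (max (y₂ u) 0) ^ (1 / p) -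
    (|c₁| + M) * |(max (y₂ u) 0) ^ (1 / p) - (max (y₁ u) 0) ^ (1 / p)| with hψ
  have hψc : ContinuousOn ψ (Icc 0 s) :=
    (continuousOn_const.mul (hYc hy₂.cara.1)).sub
      (continuousOn_const.mul ((hYc hy₂.cara.1).sub (hYc hy₁.cara.1)).abs)
  have hψs : 0 < ψ s := by
    simp only [hψ, hys, sub_self, abs_zero, mul_zero, sub_zero, max_eq_left hpos.le]
    exact mul_pos (sub_pos.2 hc) (Real.rpow_pos_of_pos hpos _)
  obtain ⟨t, ht, hP⟩ := exists_forall_mem_Icc_of_eventually H.pos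
    ((hψc s hsI).eventually_const_lt (half_lt_self hψs))
  have htI := Ioo_subset_Icc_self ht
  have e1 := hy₁.cara.sub_eq_integral (H.intervalIntegrable c₁ hy₁.cara.1) htI hsI
  have e2 := hy₂.cara.sub_eq_integral (H.intervalIntegrable c₂ hy₂.cara.1) htI hsI
  have i1 := H.intervalIntegrable_sub c₁ hy₁.cara.1 htI hsI
  have i2 := H.intervalIntegrable_sub c₂ hy₂.cara.1 htI hsI
  have h3 := integral_mono_on ht.2.le
    (i1.add (intervalIntegrable_const (c := p' * (ψ s / 2)))) i2 fun u hu => by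
      have h4 := hP u hu
      have h5 := hM u ⟨ht.1.le.trans hu.1, hu.2⟩
      have h6 : |(c₁ - h u) * ((max (y₂ u) 0) ^ (1 / p) - (max (y₁ u) 0) ^ (1 / p))| ≤
          (|c₁| + M) * |(max (y₂ u) 0) ^ (1 / p) - (max (y₁ u) 0) ^ (1 / p)| := by
        rw [abs_mul]
        refine mul_le_mul_of_nonneg_right ?_ (abs_nonneg _)
        exact (abs_sub _ _).trans (by linarith)
      have h7 := (abs_le.1 h6).1
      simp only [hψ] at h4
      rw [← mul_add]
      refine mul_le_mul_of_nonneg_left ?_ H.conj_pos.le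
      simp only [hψ]
      linarith
  rw [integral_add i1 intervalIntegrable_const, intervalIntegral.integral_const,
        smul_eq_mul] at h3
  have h4 : 0 < (s - t) * (p' * (ψ s / 2)) :=
    mul_pos (sub_pos.2 ht.2) (mul_pos H.conj_pos (half_pos hψs))
  have h5 := H.mono hy₁ hy₂ hc.le t htI
  linarith

theorem exists_sol (H : HalfProblem p p' s h f) (c : ℝ) :
    ∃ y, IsHalfSol p p' s h f c y := by
  obtain ⟨M, hM⟩ := H.bounded
  have hp0 := H.p_pos
  have hα0 : 0 < 1 / p := one_div_pos.2 H.p_pos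
  have hα1 : 1 / p < 1 := by rw [div_lt_one H.p_pos]; exact H.one_lt
  have hp'0 := H.conj_pos
  have hM0 : 0 ≤ M := (abs_nonneg _).trans (hM 0 (left_mem_Icc.2 H.pos.le))
  let k : ℝ → ℝ := (Icc 0 s).indicator fun u => p' * (c - h u)
  have hk : Measurable k :=
    ((measurable_const.sub H.measurable).const_mul p').indicator measurableSet_Icc
  have hch : ∀ u ∈ Icc 0 s, |c - h u| ≤ |c| + M := fun u hu =>
    (abs_sub _ _).trans (by linarith [hM u hu])
  have hkb : ∀ t, |k t| ≤ p' * (|c| + M) := by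
    intro t
    by_cases ht : t ∈ Icc 0 s
    · simp only [k, indicator_of_mem ht, abs_mul, abs_of_pos hp'0]
      exact mul_le_mul_of_nonneg_left (hch t ht) hp'0.le
    · simp only [k, indicator_of_notMem ht, abs_zero]
      positivity
  let f' : ℝ → ℝ := (Ioc 0 s).indicator f
  have hf' : Integrable f' := by
    rw [integrable_indicator_iff measurableSet_Ioc, integrableOn_Ioc_iff_integrableOn_Ioo]
    exact H.integrableOn
  have hFc : Continuous fun t => ∫ u in (0 : ℝ)..t, p' * -f' u :=
    continuous_primitive (fun a b => (hf'.neg.const_mul p').intervalIntegrable) 0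
  obtain ⟨y, hyc, hy⟩ := exists_integral_eq_rpow H.pos.le hα0 hα1 hk hkb hFc
  have hy0 : y 0 = 0 := by
    rw [hy 0 (left_mem_Icc.2 H.pos.le)]
    simp
  have hcara : IsCaraSol p p' h f c 0 s y := by
    refine ⟨hyc.continuousOn, fun t ht => ?_⟩
    have hI := H.intervalIntegrable_sub c hyc.continuousOn (left_mem_Icc.2 H.pos.le) ht
    have hfI : IntervalIntegrable (fun u => p' * -f' u) volume 0 t :=
      (hf'.neg.const_mul p').intervalIntegrable
    have heq : ∀ u ∈ Ioc 0 t, p' * ((c - h u) * (max (y u) 0) ^ (1 / p) - f u) =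
        p' * -f' u + k u * (max (y u) 0) ^ (1 / p) := by
      intro u hu
      have hu1 : u ∈ Ioc 0 s := ⟨hu.1, hu.2.trans ht.2⟩
      simp only [f', k, indicator_of_mem hu1, indicator_of_mem (Ioc_subset_Icc_self hu1)]
      ring
    have hkI : IntervalIntegrable (fun u => k u * (max (y u) 0) ^ (1 / p)) volume 0 t := by
      refine (hI.sub hfI).congr fun u hu => ?_
      rw [uIoc_of_le ht.1] at hu
      simp only [heq u hu, add_sub_cancel_left]
    rw [hy0, zero_add, hy t ht, ← integral_add hfI hkI]
    refine integral_congr_ae (ae_of_all _ fun u hu => ?_)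
    rw [uIoc_of_le ht.1] at hu
    exact (heq u hu).symm
  have hnn : ∀ t ∈ Icc 0 s, 0 ≤ y t := by
    intro t ht
    have := nonpos_of_antitone_where_pos (d := fun t => -y t) hyc.continuousOn.neg (by simp [hy0])
      (fun τ t h1 h2 h3 h4 => by
        have h5 := hcara.sub_eq_integral (H.intervalIntegrable c hyc.continuousOn)
          (⟨h1.le, (h2.trans_lt h3).le⟩ : τ ∈ Icc 0 s) ⟨(h1.trans_le h2).le, h3.le⟩
        have h6 : 0 ≤ ∫ u in τ..t, p' * ((c - h u) * (max (y u) 0) ^ (1 / p) - f u) := by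
          refine integral_nonneg h2 fun u hu => mul_nonneg hp'0.le ?_
          have h7 := H.f_nonpos (h1.trans_le hu.1) (hu.2.trans h3.le)
          have h8 := h4 u hu
          rw [max_eq_right (by linarith), Real.zero_rpow hα0.ne']
          linarith
        linarith) t ht
    linarith
  refine ⟨y, hcara, hy0, fun t₀ ht₀ => ?_⟩
  refine lt_of_le_of_ne (hnn t₀ (Ioo_subset_Icc_self ht₀)) fun h0 => ?_
  have hft := H.neg t₀ ht₀
  have hev1 : ∀ᶠ u in 𝓝[Icc 0 t₀] t₀, f u < f t₀ / 2 := by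
    have h1 := H.usc t₀ ht₀ (f t₀ / 2) (by linarith)
    rw [isOpen_Ioo.nhdsWithin_eq ht₀] at h1
    exact nhdsWithin_le_nhds h1
  have hev2 : ∀ᶠ u in 𝓝[Icc 0 t₀] t₀, (|c| + M) * (max (y u) 0) ^ (1 / p) < -f t₀ / 4 := by
    have h1 : Continuous fun u => (|c| + M) * (max (y u) 0) ^ (1 / p) :=
      continuous_const.mul ((hyc.max continuous_const).rpow_const fun _ => Or.inr hα0.le)
    refine nhdsWithin_le_nhds (h1.continuousAt.eventually_lt_const ?_)
    dsimp only
    rw [← h0, max_self, Real.zero_rpow hα0.ne']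
    linarith
  obtain ⟨t, ht, hP⟩ := exists_forall_mem_Icc_of_eventually ht₀.1 (hev1.and hev2)
  have htI : t ∈ Icc 0 s := ⟨ht.1.le, (ht.2.trans ht₀.2).le⟩
  have e1 := hcara.sub_eq_integral (H.intervalIntegrable c hyc.continuousOn) htI
    (Ioo_subset_Icc_self ht₀)
  have h3 := integral_mono_on ht.2.le (intervalIntegrable_const (c := p' * (-f t₀ / 4)))
    (H.intervalIntegrable_sub c hyc.continuousOn htI (Ioo_subset_Icc_self ht₀)) fun u hu => by
      obtain ⟨h4, h5⟩ := hP u hu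
      refine mul_le_mul_of_nonneg_left ?_ hp'0.le
      have h6 : |(c - h u) * (max (y u) 0) ^ (1 / p)| ≤ (|c| + M) * (max (y u) 0) ^ (1 / p) := by
        rw [abs_mul, abs_of_nonneg (Real.rpow_nonneg (le_max_right (y u) 0) (1 / p))]
        exact mul_le_mul_of_nonneg_right (hch u ⟨ht.1.le.trans hu.1, hu.2.trans ht₀.2.le⟩)
          (Real.rpow_nonneg (le_max_right (y u) 0) (1 / p))
      have h7 := (abs_le.1 h6).1
      linarith
  rw [intervalIntegral.integral_const, smul_eq_mul] at h3
  have h4 : 0 < (t₀ - t) * (p' * (-f t₀ / 4)) :=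
    mul_pos (sub_pos.2 ht.2) (mul_pos hp'0 (by linarith))
  have := hnn t htI
  linarith

theorem sub_lt_of_right_ne_zero (H : HalfProblem p p' s h f) (hy : IsHalfSol p p' s h f c y)
    (hys : y s ≠ 0) {m μ : ℝ} (hm : ∀ t ∈ Ioo 0 s, m ≤ h t)
    (hμ : ∀ t ∈ Ioo 0 s, -f t / (s - t) ^ (p' - 1) ≤ μ) :
    m - p' ^ (1 / p') * p ^ (1 / p) * μ ^ (1 / p') < c := by
  by_contra! hc
  have hp0 := H.p_pos
  have hp'0 := H.conj_pos
  have hq := H.conj_sub_one_pos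
  have hμ0 : 0 < μ := by
    have ht : s / 2 ∈ Ioo 0 s := ⟨half_pos H.pos, half_lt_self H.pos⟩
    exact (div_pos (neg_pos.2 (H.neg _ ht))
      (Real.rpow_pos_of_pos (sub_pos.2 ht.2) _)).trans_le (hμ _ ht)
  have hA : 0 < ((p' - 1) * μ) ^ (1 / p') := Real.rpow_pos_of_pos (mul_pos hq hμ0) _
  refine hys (H.right_eq_zero_of_le hy (μ := μ) (fun t ht => ?_) (fun t ht => ?_) hA
    (le_of_eq ?_) (κ := p' ^ (1 / p') * p ^ (1 / p) * μ ^ (1 / p')))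
  · linarith [hm t ht]
  · exact (div_le_iff₀ (Real.rpow_pos_of_pos (sub_pos.2 ht.2) _)).1 (hμ t ht)
  · have hpq : p' - 1 = p' / p := by
      have h1 : p - 1 ≠ 0 := by linarith [H.one_lt]
      rw [H.conj_eq]
      field_simp
      ring
    have hconj : 1 / p = 1 - 1 / p' := by
      rw [← H.one_div_conj_mul, mul_sub, one_div_mul_cancel hp'0.ne', mul_one]
    have e1 : (((p' - 1) * μ) ^ (1 / p')) ^ (-(p' - 1)) =
        ((p' - 1) * μ) ^ (1 / p') / ((p' - 1) * μ) := by
      rw [neg_sub, Real.rpow_sub hA, Real.rpow_one, ← Real.rpow_mul (mul_pos hq hμ0).le,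
        one_div_mul_cancel hp'0.ne', Real.rpow_one]
    have e2 : ((p' - 1) * μ) ^ (1 / p') = p' ^ (1 / p') / p ^ (1 / p') * μ ^ (1 / p') := by
      rw [Real.mul_rpow hq.le hμ0.le, hpq, Real.div_rpow hp'0.le hp0.le]
    have e3 : p ^ (1 / p) = p / p ^ (1 / p') := by
      rw [hconj, Real.rpow_sub hp0, Real.rpow_one]
    have e4 : p' = (p' - 1) * p := by
      rw [hpq, div_mul_cancel₀ _ hp0.ne']
    have e5 : 0 < p ^ (1 / p') := Real.rpow_pos_of_pos hp0 _
    rw [e1, e2, e3]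
    have e6 : μ * (p' ^ (1 / p') / p ^ (1 / p') * μ ^ (1 / p') / ((p' - 1) * μ)) =
        p' ^ (1 / p') / p ^ (1 / p') * μ ^ (1 / p') * (p - 1) := by
      have e7 : (p' - 1) * (p - 1) = 1 := by linarith
      field_simp
      linear_combination (-1 : ℝ) * e7
    rw [e6]
    field_simp
    ring

end HalfProblem

namespace HalfProblem

variable {p p' s c c₁ c₂ : ℝ} {h f y y₁ y₂ : ℝ → ℝ}

theorem continuous_right_rpow (H : HalfProblem p p' s h f) {Y : ℝ → ℝ → ℝ}
    (hY : ∀ c, IsHalfSol p p' s h f c (Y c)) : Continuous fun c => Y c s ^ (1 / p') := by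
  have hsI : s ∈ Icc 0 s := right_mem_Icc.2 H.pos.le
  refine (LipschitzWith.of_le_add_mul s.toNNReal fun c₁ c₂ => ?_).continuous
  rw [Real.dist_eq, Real.coe_toNNReal s H.pos.le]
  rcases le_total c₁ c₂ with hc | hc
  · have h1 := H.rpow_mono (hY c₁) (hY c₂) hc s hsI
    have h2 := mul_nonneg H.pos.le (abs_nonneg (c₁ - c₂))
    linarith
  · have h1 := H.rpow_sub_le (hY c₂) (hY c₁) hc s hsI
    rw [abs_of_nonneg (sub_nonneg.2 hc)]
    linarith

theorem exists_le_right_rpow (H : HalfProblem p p' s h f) {Y : ℝ → ℝ → ℝ}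
    (hY : ∀ c, IsHalfSol p p' s h f c (Y c)) {B : ℝ} (hB : 0 ≤ B) :
    ∃ C, 0 ≤ C ∧ B ≤ Y C s ^ (1 / p') := by
  obtain ⟨M, hM⟩ := H.bounded
  have hM0 : 0 ≤ M := (abs_nonneg _).trans (hM 0 (left_mem_Icc.2 H.pos.le))
  refine ⟨M + B / s, add_nonneg hM0 (div_nonneg hB H.pos.le), ?_⟩
  have h1 := H.mul_le_rpow (hY (M + B / s)) hM s (right_mem_Icc.2 H.pos.le)
  rwa [add_sub_cancel_left, div_mul_cancel₀ _ H.pos.ne'] at h1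

section Matching

variable {s₁ s₂ : ℝ} {h₁ f₁ h₂ f₂ : ℝ → ℝ}

theorem exists_right_eq (H₁ : HalfProblem p p' s₁ h₁ f₁) (H₂ : HalfProblem p p' s₂ h₂ f₂) :
    ∃ c y₁ y₂, IsHalfSol p p' s₁ h₁ f₁ c y₁ ∧ IsHalfSol p p' s₂ h₂ f₂ (-c) y₂ ∧
      y₁ s₁ = y₂ s₂ := by
  choose Y₁ hY₁ using H₁.exists_sol
  choose Y₂ hY₂ using H₂.exists_sol
  have hI₁ : s₁ ∈ Icc 0 s₁ := right_mem_Icc.2 H₁.pos.le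
  have hI₂ : s₂ ∈ Icc 0 s₂ := right_mem_Icc.2 H₂.pos.le
  have n₁ := fun c => nonneg (hY₁ c) s₁ hI₁
  have n₂ := fun c => nonneg (hY₂ c) s₂ hI₂
  have hcont : Continuous fun c => Y₁ c s₁ ^ (1 / p') - Y₂ (-c) s₂ ^ (1 / p') :=
    (H₁.continuous_right_rpow hY₁).sub ((H₂.continuous_right_rpow hY₂).comp continuous_neg)
  obtain ⟨C₁, hC₁, hB₁⟩ := H₁.exists_le_right_rpow hY₁ (Real.rpow_nonneg (n₂ 0) (1 / p'))
  obtain ⟨C₂, hC₂, hB₂⟩ := H₂.exists_le_right_rpow hY₂ (Real.rpow_nonneg (n₁ 0) (1 / p'))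
  obtain ⟨c, hc⟩ := mem_range_of_exists_le_of_exists_ge (c := (0 : ℝ)) hcont
    ⟨-C₂, by
      have := H₁.rpow_mono (hY₁ (-C₂)) (hY₁ 0) (by linarith) s₁ hI₁
      rw [neg_neg]
      linarith⟩
    ⟨C₁, by
      have := H₂.rpow_mono (hY₂ (-C₁)) (hY₂ 0) (by linarith) s₂ hI₂
      linarith⟩
  exact ⟨c, Y₁ c, Y₂ (-c), hY₁ c, hY₂ (-c), (Real.rpow_left_inj (n₁ _) (n₂ _)
    (one_div_pos.2 H₁.conj_pos).ne').1 (sub_eq_zero.1 hc)⟩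

theorem le_of_right_eq (H₁ : HalfProblem p p' s₁ h₁ f₁) (H₂ : HalfProblem p p' s₂ h₂ f₂)
    {z₁ z₂ : ℝ → ℝ}
    (hy₁ : IsHalfSol p p' s₁ h₁ f₁ c₁ y₁) (hy₂ : IsHalfSol p p' s₂ h₂ f₂ (-c₁) y₂)
    (hz₁ : IsHalfSol p p' s₁ h₁ f₁ c₂ z₁) (hz₂ : IsHalfSol p p' s₂ h₂ f₂ (-c₂) z₂)
    (hy : y₁ s₁ = y₂ s₂) (hz : z₁ s₁ = z₂ s₂) (hne : z₁ s₁ ≠ 0) : c₂ ≤ c₁ := by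
  by_contra! hc
  have e₁ := H₁.mono hy₁ hz₁ hc.le s₁ (right_mem_Icc.2 H₁.pos.le)
  have e₂ := H₂.mono hz₂ hy₂ (neg_le_neg hc.le) s₂ (right_mem_Icc.2 H₂.pos.le)
  exact hne (H₁.right_eq_zero_of_right_eq hy₁ hz₁ hc (e₁.antisymm (by linarith)))

end Matching

end HalfProblem

section Reflection

variable {p p' s c : ℝ} {h f y y₁ y₂ : ℝ → ℝ}

theorem isHalfSol_of_isPosBVPSol (H₁ : HalfProblem p p' s h f) (hs : s < 1)
    (hi : IntervalIntegrable (fun u => p' * ((c - h u) * (max (y u) 0) ^ (1 / p) - f u))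
      volume 0 1) (hy : IsPosBVPSol p p' h f c 0 1 y) :
    IsHalfSol p p' s h f c y ∧ IsHalfSol p p' (1 - s) (fun t => -h (1 - t))
      (fun t => -f (1 - t)) (-c) (fun t => y (1 - t)) := by
  obtain ⟨hc, h0, h1, hpos⟩ := hy
  have hs0 := H₁.pos
  refine ⟨⟨hc.restrict hi le_rfl hs.le, h0, fun t ht => hpos t ⟨ht.1, ht.2.trans hs⟩⟩, ?_, ?_,
    fun t ht => hpos _ ⟨?_, ?_⟩⟩
  · have hr := (hc.restrict hi hs0.le le_rfl).reflect (hi.mono_set (by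
      rw [uIcc_of_le hs.le, uIcc_of_le zero_le_one]
      exact Icc_subset_Icc_left hs0.le))
    rwa [sub_self] at hr
  · simpa using h1
  · linarith [ht.2]
  · linarith [ht.1]

theorem exists_isPosBVPSol (H₁ : HalfProblem p p' s h f)
    (H₂ : HalfProblem p p' (1 - s) (fun t => -h (1 - t)) (fun t => -f (1 - t)))
    (hy₁ : IsHalfSol p p' s h f c y₁)
    (hy₂ : IsHalfSol p p' (1 - s) (fun t => -h (1 - t)) (fun t => -f (1 - t)) (-c) y₂)
    (hm : y₁ s = y₂ (1 - s)) (hpos : y₁ s ≠ 0) : ∃ y, IsPosBVPSol p p' h f c 0 1 y := by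
  have hs : s < 1 := sub_pos.1 H₂.pos
  have hr := hy₂.cara.reflect (H₂.intervalIntegrable _ hy₂.cara.1)
  simp only [sub_sub_cancel, neg_neg, sub_zero] at hr
  obtain ⟨M, hM⟩ := H₂.bounded
  have hf : IntegrableOn f (Ioo s 1) := by
    have h1 := (intervalIntegrable_iff_integrableOn_Ioo_of_le H₂.pos.le).2 H₂.integrableOn
    have h2 : IntervalIntegrable (fun t => - -f (1 - (1 - t))) volume (1 - (1 - s)) (1 - 0) :=
      (h1.comp_sub_left 1).neg.symm
    simp only [sub_sub_cancel, neg_neg, sub_zero] at h2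
    exact (intervalIntegrable_iff_integrableOn_Ioo_of_le hs.le).1 h2
  have hi₂ : IntervalIntegrable (fun u => p' * ((c - h u) * (max (y₂ (1 - u)) 0) ^ (1 / p) - f u))
      volume s 1 := by
    refine intervalIntegrable_rhs H₁.p_pos hs.le H₁.measurable (M := M) (fun t ht => ?_) hf hr.1
    have := hM (1 - t) ⟨by linarith [ht.2], by linarith [ht.1]⟩
    simpa using this
  refine ⟨_, hy₁.cara.glue hr H₁.pos.le hs.le hm (H₁.intervalIntegrable _ hy₁.cara.1) hi₂,
    ?_, ?_, fun t ht => ?_⟩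
  · simp [H₁.pos.le, hy₁.zero]
  · simp [hs, hy₂.zero]
  · split_ifs with hts
    · rcases hts.lt_or_eq with hlt | rfl
      · exact hy₁.pos t ⟨ht.1, hlt⟩
      · exact lt_of_le_of_ne (HalfProblem.nonneg hy₁ t (right_mem_Icc.2 H₁.pos.le)) hpos.symm
    · exact hy₂.pos _ ⟨by linarith [ht.2], by linarith [not_le.1 hts]⟩

end Reflection

theorem exists_real_eventually_lt_of_bot_lt_liminf {α : Type*} {l : Filter α} {u : α → ℝ}
    (hu : ⊥ < liminf (fun t => (u t : EReal)) l) : ∃ k : ℝ, ∀ᶠ t in l, k < u t := by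
  obtain ⟨k, hk⟩ := EReal.lt_iff_exists_real_btwn.1 hu
  exact ⟨k, by simpa using eventually_lt_of_lt_liminf hk.2⟩

theorem exists_real_eventually_lt_of_limsup_lt_top {α : Type*} {l : Filter α} {u : α → ℝ}
    (hu : limsup (fun t => (u t : EReal)) l < ⊤) : ∃ k : ℝ, ∀ᶠ t in l, u t < k := by
  obtain ⟨k, hk⟩ := EReal.lt_iff_exists_real_btwn.1 hu
  exact ⟨k, by simpa using eventually_lt_of_limsup_lt hk.1⟩

theorem stmt_14
    (p p' s : ℝ) (h f : ℝ → ℝ)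
    (hp : 1 < p) (hp'def : p' = p / (p - 1))
    (hs : s ∈ Set.Ioo (0:ℝ) 1)
    (hmeas : Measurable h)
    (hbd : ∃ M : ℝ, ∀ t ∈ Set.Icc (0:ℝ) 1, |h t| ≤ M)
    (hfint : MeasureTheory.IntegrableOn f (Set.Ioo (0:ℝ) 1))
    (hf0 : f 0 = 0) (hfs : f s = 0) (hf1 : f 1 = 0)
    (hfneg : ∀ t ∈ Set.Ioo (0:ℝ) s, f t < 0)
    (hfpos : ∀ t ∈ Set.Ioo s (1:ℝ), 0 < f t)
    (husc : UpperSemicontinuousOn f (Set.Ioo (0:ℝ) s))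
    (hlsc : LowerSemicontinuousOn f (Set.Ioo s (1:ℝ)))
    (hhc : ContinuousAt h s)
    (hhfin : ∃ S : Finset ℝ, ContinuousOn h (Set.Icc (0:ℝ) 1 \ ↑S))
    (hint : 0 ≤ ∫ t in (0:ℝ)..1, f t)
    (hcond :
      ⊥ < Filter.liminf
          (fun t => (((s - t) ^ (p' - 1) * (h s - h t) / (-f t) : ℝ) : EReal)) (𝓝[<] s) ∨
      Filter.limsup
          (fun t => (((t - s) ^ (p' - 1) * (h s - h t) / f t : ℝ) : EReal)) (𝓝[>] s) < ⊤) :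
    ∃ cstar : ℝ,
      (∀ c : ℝ, (∃ y, IsPosBVPSol p p' h f c 0 1 y) ↔ c = cstar) ∧
      (∀ y₁ y₂, IsPosBVPSol p p' h f cstar 0 1 y₁ → IsPosBVPSol p p' h f cstar 0 1 y₂ →
        Set.EqOn y₁ y₂ (Set.Icc 0 1)) ∧
      (BddAbove {x : ℝ | ∃ t ∈ Set.Ioo (0:ℝ) s, x = -f t / (s - t) ^ (p' - 1)} →
        sInf (h '' Set.Icc (0:ℝ) s) -
          p' ^ (1 / p') * p ^ (1 / p) *
            (sSup {x : ℝ | ∃ t ∈ Set.Ioo (0:ℝ) s, x = -f t / (s - t) ^ (p' - 1)}) ^ (1 / p')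
          < cstar) ∧
      (BddAbove {x : ℝ | ∃ t ∈ Set.Ioo s (1:ℝ), x = f t / (t - s) ^ (p' - 1)} →
        cstar <
          sSup (h '' Set.Icc s (1:ℝ)) +
            p' ^ (1 / p') * p ^ (1 / p) *
              (sSup {x : ℝ | ∃ t ∈ Set.Ioo s (1:ℝ), x = f t / (t - s) ^ (p' - 1)}) ^ (1 / p')) := by
  obtain ⟨hs0, hs1⟩ := hs
  obtain ⟨M, hM⟩ := hbd
  have H₁ : HalfProblem p p' s h f :=
    { one_lt := hp
      conj_eq := hp'def
      pos := hs0
      measurable := hmeas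
      bounded := ⟨M, fun t ht => hM t ⟨ht.1, ht.2.trans hs1.le⟩⟩
      integrableOn := hfint.mono_set (Ioo_subset_Ioo_right hs1.le)
      zero_right := hfs
      neg := hfneg
      usc := husc }
  have hmaps : MapsTo (fun t : ℝ => 1 - t) (Ioo 0 (1 - s)) (Ioo s 1) := fun t ht =>
    ⟨by linarith [ht.2], by linarith [ht.1]⟩
  have H₂ : HalfProblem p p' (1 - s) (fun t => -h (1 - t)) (fun t => -f (1 - t)) :=
    { one_lt := hp
      conj_eq := hp'def
      pos := sub_pos.2 hs1
      measurable := (hmeas.comp (measurable_const.sub measurable_id)).neg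
      bounded := ⟨M, fun t ht => by
        rw [abs_neg]
        exact hM _ ⟨by linarith [ht.2], by linarith [ht.1]⟩⟩
      integrableOn := by
        have h1 := (intervalIntegrable_iff_integrableOn_Ioo_of_le hs1.le).2
          (hfint.mono_set (Ioo_subset_Ioo_left hs0.le))
        have h2 := (h1.comp_sub_left 1).neg.symm
        rw [sub_self] at h2
        exact (intervalIntegrable_iff_integrableOn_Ioo_of_le (sub_pos.2 hs1).le).1 h2
      zero_right := by simp [hfs]
      neg := fun t ht => neg_neg_of_pos (hfpos _ (hmaps ht))
      usc := fun t ht b hb => by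
        have h1 := hlsc (1 - t) (hmaps ht) (-b) (by linarith)
        have h2 : Tendsto (fun t : ℝ => 1 - t) (𝓝[Ioo 0 (1 - s)] t) (𝓝[Ioo s 1] (1 - t)) :=
          (continuous_const.sub continuous_id).continuousWithinAt.tendsto_nhdsWithin hmaps
        filter_upwards [h2.eventually h1] with x hx
        linarith }
  have hint₁ : ∀ {c : ℝ} {y : ℝ → ℝ}, IsPosBVPSol p p' h f c 0 1 y → IntervalIntegrable
      (fun u => p' * ((c - h u) * (max (y u) 0) ^ (1 / p) - f u)) volume 0 1 := fun hy =>
    intervalIntegrable_rhs H₁.p_pos zero_le_one hmeas hM hfint hy.1.1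
  obtain ⟨c, y₁, y₂, hy₁, hy₂, hm⟩ := H₁.exists_right_eq H₂
  have hhc₂ : ContinuousAt (fun t => -h (1 - t)) (1 - s) := by
    refine ContinuousAt.neg (ContinuousAt.comp (g := h) ?_ (by fun_prop))
    rwa [sub_sub_cancel]
  have hne : y₁ s ≠ 0 := by
    intro h0
    have h1 := H₁.le_of_right_eq_zero hy₁ hhc h0
    have h2 := H₂.le_of_right_eq_zero hy₂ hhc₂ (hm ▸ h0)
    rw [sub_sub_cancel] at h2
    obtain rfl : c = h s := by linarith
    rcases hcond with hl | hr
    · obtain ⟨k, hk⟩ := exists_real_eventually_lt_of_bot_lt_liminf hl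
      exact H₁.right_ne_zero hy₁ hhc hk h0
    · obtain ⟨k, hk⟩ := exists_real_eventually_lt_of_limsup_lt_top hr
      have h3 : Tendsto (fun t : ℝ => 1 - t) (𝓝[<] (1 - s)) (𝓝[>] s) := by
        have h4 : ContinuousWithinAt (fun t : ℝ => 1 - t) (Iio (1 - s)) (1 - s) := by fun_prop
        have h5 := h4.tendsto_nhdsWithin (t := Ioi s) fun t (ht : t < 1 - s) =>
          show s < 1 - t by linarith
        rwa [sub_sub_cancel] at h5
      have hhs : -h s = -h (1 - (1 - s)) := by rw [sub_sub_cancel]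
      rw [hhs] at hy₂
      refine H₂.right_ne_zero hy₂ hhc₂ (k := -k) ?_ (hm ▸ h0)
      filter_upwards [h3.eventually hk] with t ht
      have e1 : (1 - s - t) ^ (p' - 1) * (-h (1 - (1 - s)) - -h (1 - t)) / (- -f (1 - t)) =
          -((1 - t - s) ^ (p' - 1) * (h s - h (1 - t)) / f (1 - t)) := by
        rw [sub_sub_cancel, neg_neg, sub_right_comm]
        ring
      rw [e1]
      exact neg_lt_neg ht
  have hsym : ∀ y : ℝ → ℝ, y s = (fun t => y (1 - t)) (1 - s) := fun y => by
    simp only [sub_sub_cancel]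
  refine ⟨c, fun d => ⟨?_, ?_⟩, fun u v hu hv t ht => ?_, fun hb => ?_, fun hb => ?_⟩
  · rintro ⟨y, hy⟩
    obtain ⟨hz₁, hz₂⟩ := isHalfSol_of_isPosBVPSol H₁ hs1 (hint₁ hy) hy
    exact le_antisymm
      (H₁.le_of_right_eq H₂ hy₁ hy₂ hz₁ hz₂ hm (hsym y) (hy.2.2.2 s ⟨hs0, hs1⟩).ne')
      (H₁.le_of_right_eq H₂ hz₁ hz₂ hy₁ hy₂ (hsym y) hm hne)
  · rintro rfl
    exact exists_isPosBVPSol H₁ H₂ hy₁ hy₂ hm hne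
  · obtain ⟨hu₁, hu₂⟩ := isHalfSol_of_isPosBVPSol H₁ hs1 (hint₁ hu) hu
    obtain ⟨hv₁, hv₂⟩ := isHalfSol_of_isPosBVPSol H₁ hs1 (hint₁ hv) hv
    rcases le_total t s with hts | hts
    · exact H₁.unique hu₁ hv₁ ⟨ht.1, hts⟩
    · simpa using H₂.unique hu₂ hv₂
        (⟨by linarith [ht.2], by linarith⟩ : 1 - t ∈ Icc 0 (1 - s))
  · refine H₁.sub_lt_of_right_ne_zero hy₁ hne (fun t ht => csInf_le ⟨-M, ?_⟩
      (mem_image_of_mem h (Ioo_subset_Icc_self ht))) fun t ht => le_csSup hb ⟨t, ht, rfl⟩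
    rintro _ ⟨u, hu, rfl⟩
    exact (abs_le.1 (hM u ⟨hu.1, hu.2.trans hs1.le⟩)).1
  · have h1 := H₂.sub_lt_of_right_ne_zero hy₂ (hm ▸ hne) (m := -sSup (h '' Icc s 1))
      (fun t ht => neg_le_neg (le_csSup ⟨M, ?_⟩
        (mem_image_of_mem h (Ioo_subset_Icc_self (hmaps ht)))))
      fun t ht => le_csSup hb ⟨1 - t, hmaps ht, by rw [neg_neg, sub_right_comm]⟩
    · linarith
    · rintro _ ⟨u, hu, rfl⟩
      exact (abs_le.1 (hM u ⟨hs0.le.trans hu.1, hu.2⟩)).2
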